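/- Let γ be a ribbon, and for t ∈ (0,1] let ψ_t be the parametrized surface associated to the scaled curve tγ, i.e. ψ_t(u,v) = ((tγ₁(u))F_t(u,v), (tγ₂(u))F_t(u,v), R_t(u) sin(v/R_t(u))) with R_t(u) = (1/(t‖γ(u)‖) − t‖γ(u)‖)/2 and F_t(u,v) = 1 + (R_t(u)/(t‖γ(u)‖))(1 − cos(v/R_t(u))). Then there exists t₀ ∈ (0,1] such that for every t ∈ (0, t₀], every u ∈ (−u₂, u₂) and every v with ‖ψ_t(u,v)‖ ≤ 1, writing n = ψ_{t,u}(u,v) × ψ_{t,v}(u,v), one has ⟨ψ_{t,uu}, n⟩·⟨ψ_{t,vv}, n⟩ − ⟨ψ_{t,uv}, n⟩² ≤ 0. (For t small, the curved piece of the free boundary disk associated to the scaled ribbon is a saddle surface: its Gaussian curvature is nonpositive.) -/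

import Mathlib

open Real Set

noncomputable section

/-- Euclidean dot product on `ℝ²` (represented as `ℝ × ℝ`). -/
def dot2 (a b : ℝ × ℝ) : ℝ := a.1 * b.1 + a.2 * b.2

/-- Determinant of two vectors in `ℝ²`. -/
def det2 (a b : ℝ × ℝ) : ℝ := a.1 * b.2 - a.2 * b.1

/-- Euclidean norm on `ℝ²`. -/
def norm2 (a : ℝ × ℝ) : ℝ := Real.sqrt (a.1 ^ 2 + a.2 ^ 2)

/-- Euclidean dot product on `ℝ³` (represented as `ℝ × ℝ × ℝ`). -/
def dot3 (a b : ℝ × ℝ × ℝ) : ℝ := a.1 * b.1 + a.2.1 * b.2.1 + a.2.2 * b.2.2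

/-- Cross product on `ℝ³`. -/
def cross3 (a b : ℝ × ℝ × ℝ) : ℝ × ℝ × ℝ :=
  (a.2.1 * b.2.2 - a.2.2 * b.2.1, a.2.2 * b.1 - a.1 * b.2.2, a.1 * b.2.1 - a.2.1 * b.1)

/-- Euclidean norm on `ℝ³`. -/
def norm3 (a : ℝ × ℝ × ℝ) : ℝ := Real.sqrt (a.1 ^ 2 + a.2.1 ^ 2 + a.2.2 ^ 2)

/-- A *ribbon*: a `C^∞` planar curve `γ : [-u₃, u₃] → ℝ²`, parametrized by arc length and
contained in the closed unit disk, which is symmetric with respect to the line `{x = y}`,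
parametrizes the vertical segment `{0} × [-1, a]` on `[u₂, u₃]`, is an embedded strictly convex
arc contained in the open quadrant `(0,1) × (0,1)` on `(-u₂, u₂)`, and whose curvature
`κ = det (γ', γ'')` is strictly decreasing on `(u₁, u₂)`.
(The curve is given as a globally defined `C^∞` map `ℝ → ℝ × ℝ`; all the geometric
conditions are imposed on `[-u₃, u₃]`.) -/
structure Ribbon where
  γ : ℝ → ℝ × ℝ
  u₁ : ℝ
  u₂ : ℝ
  u₃ : ℝ
  a : ℝ
  hu₁ : 0 < u₁
  h₁₂ : u₁ < u₂
  h₂₃ : u₂ < u₃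
  ha : a ∈ Set.Ioo (0 : ℝ) 1
  hu₂u₃ : u₂ = u₃ - (1 + a)
  smooth : ContDiff ℝ (⊤ : ℕ∞) γ
  arclength : ∀ u ∈ Set.Icc (-u₃) u₃, norm2 (deriv γ u) = 1
  inDisk : ∀ u ∈ Set.Icc (-u₃) u₃, norm2 (γ u) ≤ 1
  symm : ∀ u ∈ Set.Icc (-u₃) u₃, γ (-u) = ((γ u).2, (γ u).1)
  segment : ∀ u ∈ Set.Icc u₂ u₃, γ u = (0, a - (u - u₂))
  quadrant : ∀ u ∈ Set.Ioo (-u₂) u₂,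
      (γ u).1 ∈ Set.Ioo (0 : ℝ) 1 ∧ (γ u).2 ∈ Set.Ioo (0 : ℝ) 1
  embedded : Set.InjOn γ (Set.Ioo (-u₂) u₂)
  convexArc : ∀ u ∈ Set.Ioo (-u₂) u₂, 0 < det2 (deriv γ u) (deriv (deriv γ) u)
  curvDecreasing :
      StrictAntiOn (fun u => det2 (deriv γ u) (deriv (deriv γ) u)) (Set.Ioo u₁ u₂)

/-- `R_t(u) = (1/(t‖γ(u)‖) - t‖γ(u)‖)/2`, for the scaled ribbon `tγ`. -/
def RT (Rb : Ribbon) (t u : ℝ) : ℝ :=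
  (1 / (t * norm2 (Rb.γ u)) - t * norm2 (Rb.γ u)) / 2

/-- `F_t(u,v) = 1 + (R_t(u)/(t‖γ(u)‖))(1 - cos(v/R_t(u)))`. -/
def FT (Rb : Ribbon) (t u v : ℝ) : ℝ :=
  1 + (RT Rb t u / (t * norm2 (Rb.γ u))) * (1 - Real.cos (v / RT Rb t u))

/-- The surface associated to the scaled ribbon `tγ`. -/
def ψT (Rb : Ribbon) (t u v : ℝ) : ℝ × ℝ × ℝ :=
  (t * (Rb.γ u).1 * FT Rb t u v, t * (Rb.γ u).2 * FT Rb t u v,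
    RT Rb t u * Real.sin (v / RT Rb t u))

/-- Partial derivative `ψ_{t,u}`. -/
def ψTu (Rb : Ribbon) (t u v : ℝ) : ℝ × ℝ × ℝ := deriv (fun s => ψT Rb t s v) u

/-- Partial derivative `ψ_{t,v}`. -/
def ψTv (Rb : Ribbon) (t u v : ℝ) : ℝ × ℝ × ℝ := deriv (fun w => ψT Rb t u w) v

/-- Second partial derivative `ψ_{t,uu}`. -/
def ψTuu (Rb : Ribbon) (t u v : ℝ) : ℝ × ℝ × ℝ := deriv (fun s => ψTu Rb t s v) u

/-- Second partial derivative `ψ_{t,uv}`. -/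
def ψTuv (Rb : Ribbon) (t u v : ℝ) : ℝ × ℝ × ℝ := deriv (fun w => ψTu Rb t u w) v

/-- Second partial derivative `ψ_{t,vv}`. -/
def ψTvv (Rb : Ribbon) (t u v : ℝ) : ℝ × ℝ × ℝ := deriv (fun w => ψTv Rb t u w) v

/-- Gaussian curvature numerator of the surface `(e₁ f, e₂ f, g)` swept by the circular arcs
`f = c - R cos (v / R)`, `g = R sin (v / R)`, where `(e₁, e₂)` rotates with angular speed `q` and
`c, R` satisfy `c' = R m`, `R' = c m`. -/
theorem rotating_arcs_curvature {e₁ e₂ c R q m : ℝ → ℝ} {ψ : ℝ → ℝ → ℝ × ℝ × ℝ} {U : Set ℝ}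
    (hU : IsOpen U) {u v q' m' : ℝ} (hu : u ∈ U)
    (hψ : ∀ s ∈ U, ∀ w, ψ s w = (e₁ s * (c s - R s * cos (w / R s)),
      e₂ s * (c s - R s * cos (w / R s)), R s * sin (w / R s)))
    (he₁ : ∀ s ∈ U, HasDerivAt e₁ (-(q s * e₂ s)) s)
    (he₂ : ∀ s ∈ U, HasDerivAt e₂ (q s * e₁ s) s)
    (hc : ∀ s ∈ U, HasDerivAt c (R s * m s) s)
    (hR : ∀ s ∈ U, HasDerivAt R (c s * m s) s)
    (hR0 : ∀ s ∈ U, R s ≠ 0)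
    (he : e₁ u ^ 2 + e₂ u ^ 2 = 1)
    (hq : HasDerivAt q q' u) (hm : HasDerivAt m m' u) :
    let ψu := fun s w => deriv (fun s => ψ s w) s
    let ψv := fun s w => deriv (fun w => ψ s w) w
    let n := cross3 (ψu u v) (ψv u v)
    dot3 (deriv (fun s => ψu s v) u) n * dot3 (deriv (fun w => ψv u w) v) n -
        dot3 (deriv (fun w => ψu u w) v) n ^ 2 =
      (c u - R u * cos (v / R u)) ^ 3 / R u * q u *
        (m u * q' - q u * m' - q u * (m u ^ 2 + q u ^ 2) * cos (v / R u)) := by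
  intro ψu ψv n
  have hS : ∀ s ∈ U, ∀ w, HasDerivAt (fun s => w / R s) (-(w * c s * m s / R s ^ 2)) s := by
    intro s hs w
    convert! (hasDerivAt_const s w).div (hR s hs) (hR0 s hs) using 1
    ring
  have hSv : ∀ s w, HasDerivAt (fun w => w / R s) (1 / R s) w := fun s w =>
    (hasDerivAt_id w).div_const (R s)
  have hf : ∀ s ∈ U, ∀ w, HasDerivAt (fun s => c s - R s * cos (w / R s))
      (m s * (R s - c s * cos (w / R s)) - w * c s * m s / R s * sin (w / R s)) s := by
    intro s hs w
    convert! (hc s hs).sub ((hR s hs).mul (hS s hs w).cos) using 1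
    have := hR0 s hs
    field_simp
    ring
  have hg : ∀ s ∈ U, ∀ w, HasDerivAt (fun s => R s * sin (w / R s))
      (c s * m s * sin (w / R s) - w * c s * m s / R s * cos (w / R s)) s := by
    intro s hs w
    convert! (hR s hs).mul (hS s hs w).sin using 1
    have := hR0 s hs
    field_simp
    ring
  have hu1 : ∀ s ∈ U, ∀ w, ψu s w =
      (-(q s * e₂ s) * (c s - R s * cos (w / R s)) +
        e₁ s * (m s * (R s - c s * cos (w / R s)) - w * c s * m s / R s * sin (w / R s)),
      q s * e₁ s * (c s - R s * cos (w / R s)) +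
        e₂ s * (m s * (R s - c s * cos (w / R s)) - w * c s * m s / R s * sin (w / R s)),
      c s * m s * sin (w / R s) - w * c s * m s / R s * cos (w / R s)) := by
    intro s hs w
    have h := ((he₁ s hs).mul (hf s hs w)).prodMk
      (((he₂ s hs).mul (hf s hs w)).prodMk (hg s hs w))
    refine (h.congr_of_eventuallyEq ?_).deriv
    filter_upwards [hU.mem_nhds hs] with x hx
    exact hψ x hx w
  have hfv : ∀ s ∈ U, ∀ w, HasDerivAt (fun w => c s - R s * cos (w / R s)) (sin (w / R s)) w := by
    intro s hs w
    convert! (((hSv s w).cos.const_mul (R s)).const_sub (c s)) using 1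
    have := hR0 s hs
    field_simp
  have hgv : ∀ s ∈ U, ∀ w, HasDerivAt (fun w => R s * sin (w / R s)) (cos (w / R s)) w := by
    intro s hs w
    convert! ((hSv s w).sin.const_mul (R s)) using 1
    have := hR0 s hs
    field_simp
  have hv1 : ∀ w, ψv u w = (e₁ u * sin (w / R u), e₂ u * sin (w / R u), cos (w / R u)) := by
    intro w
    have h := ((hfv u hu w).const_mul (e₁ u)).prodMk
      (((hfv u hu w).const_mul (e₂ u)).prodMk (hgv u hu w))
    refine (h.congr_of_eventuallyEq ?_).deriv
    exact Filter.Eventually.of_forall fun x => hψ u hu x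
  have hvv : deriv (fun w => ψv u w) v =
      (e₁ u * (cos (v / R u) * (1 / R u)), e₂ u * (cos (v / R u) * (1 / R u)),
        -sin (v / R u) * (1 / R u)) := by
    have h := ((hSv u v).sin.const_mul (e₁ u)).prodMk
      (((hSv u v).sin.const_mul (e₂ u)).prodMk (hSv u v).cos)
    refine (h.congr_of_eventuallyEq ?_).deriv
    exact Filter.Eventually.of_forall fun x => hv1 x
  have hσv : HasDerivAt (fun w => w * c u * m u / R u) (c u * m u / R u) v := by
    convert! (((hasDerivAt_id v).mul_const (c u)).mul_const (m u)).div_const (R u) using 1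
    ring
  have hfuv : HasDerivAt
      (fun w => m u * (R u - c u * cos (w / R u)) - w * c u * m u / R u * sin (w / R u))
      (-(v * c u * m u / R u ^ 2) * cos (v / R u)) v := by
    convert! ((((hSv u v).cos.const_mul (c u)).const_sub (R u)).const_mul (m u)).sub
      (hσv.mul (hSv u v).sin) using 1
    have := hR0 u hu
    field_simp
    ring
  have hguv : HasDerivAt
      (fun w => c u * m u * sin (w / R u) - w * c u * m u / R u * cos (w / R u))
      (v * c u * m u / R u ^ 2 * sin (v / R u)) v := by
    convert! ((hSv u v).sin.const_mul (c u * m u)).sub (hσv.mul (hSv u v).cos) using 1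
    have := hR0 u hu
    field_simp
    ring
  have huv : deriv (fun w => ψu u w) v =
      (-(q u * e₂ u) * sin (v / R u) + e₁ u * (-(v * c u * m u / R u ^ 2) * cos (v / R u)),
      q u * e₁ u * sin (v / R u) + e₂ u * (-(v * c u * m u / R u ^ 2) * cos (v / R u)),
      v * c u * m u / R u ^ 2 * sin (v / R u)) := by
    have h := (((hfv u hu v).const_mul (-(q u * e₂ u))).add (hfuv.const_mul (e₁ u))).prodMk
      ((((hfv u hu v).const_mul (q u * e₁ u)).add (hfuv.const_mul (e₂ u))).prodMk hguv)
    refine (h.congr_of_eventuallyEq ?_).deriv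
    exact Filter.Eventually.of_forall fun x => hu1 u hu x
  obtain ⟨σ, hσ⟩ : ∃ σ, HasDerivAt (fun s => v * c s * m s / R s) σ u :=
    ⟨_, (((hc u hu).const_mul v).mul hm).div (hR u hu) (hR0 u hu)⟩
  have hσu := hS u hu v
  have hfuu : HasDerivAt
      (fun s => m s * (R s - c s * cos (v / R s)) - v * c s * m s / R s * sin (v / R s))
      (m' * (R u - c u * cos (v / R u)) + m u * (c u * m u - R u * m u * cos (v / R u)
        - c u * sin (v / R u) * (v * c u * m u / R u ^ 2))
        - σ * sin (v / R u)
        + v * c u * m u / R u * cos (v / R u) * (v * c u * m u / R u ^ 2)) u := by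
    convert! (hm.mul ((hR u hu).sub ((hc u hu).mul hσu.cos))).sub (hσ.mul hσu.sin) using 1
    simp only [Pi.sub_apply, Pi.mul_apply]
    ring
  have hguu : HasDerivAt
      (fun s => c s * m s * sin (v / R s) - v * c s * m s / R s * cos (v / R s))
      ((R u * m u * m u + c u * m') * sin (v / R u)
        - c u * m u * cos (v / R u) * (v * c u * m u / R u ^ 2)
        - σ * cos (v / R u)
        - v * c u * m u / R u * sin (v / R u) * (v * c u * m u / R u ^ 2)) u := by
    convert! (((hc u hu).mul hm).mul hσu.sin).sub (hσ.mul hσu.cos) using 1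
    simp only [Pi.mul_apply]
    ring
  have huu := (((hq.mul (he₂ u hu)).neg.mul (hf u hu v)).add ((he₁ u hu).mul hfuu)).prodMk
      ((((hq.mul (he₁ u hu)).mul (hf u hu v)).add ((he₂ u hu).mul hfuu)).prodMk hguu)
  have huu' := (huu.congr_of_eventuallyEq (f₁ := fun s => ψu s v) (by
    filter_upwards [hU.mem_nhds hu] with x hx
    exact hu1 x hx v)).deriv
  have hn : n = cross3 (ψu u v) (ψv u v) := rfl
  rw [hn, huu', huv, hvv, hu1 u hu, hv1]
  have hRu := hR0 u hu
  have hsc := sin_sq_add_cos_sq (v / R u)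
  simp only [cross3, dot3, Pi.mul_apply, Pi.neg_apply]
  clear huu huu' hn huv hvv hv1 hu1 hfuu hguu hσu hσ hguv hfuv hσv hgv hfv hg hf hS hSv hψ
  clear hR hc he₁ he₂ hq hm
  clear_value n
  generalize sin (v / R u) = sn at *
  generalize cos (v / R u) = cs at *
  obtain ⟨ω, hω⟩ : ∃ ω, v * c u * m u / R u ^ 2 = ω := ⟨_, rfl⟩
  have hω' : v * c u * m u / R u = R u * ω := by rw [← hω]; field_simp
  rw [hω, hω']
  generalize e₁ u = a at *
  generalize e₂ u = b at *
  generalize c u = c at *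
  generalize R u = R at *
  generalize q u = q at *
  generalize m u = m at *
  set f := c - R * cs with hf
  set fu := m * (R - c * cs) - R * ω * sn with hfu
  set gu := c * m * sn - R * ω * cs with hgu
  set fuu := m' * (R - c * cs) + m * (c * m - R * m * cs - c * sn * ω) - σ * sn + R * ω * cs * ω
    with hfuu
  set guu := (R * m * m + c * m') * sn - c * m * cs * ω - σ * cs - R * ω * sn * ω with hguu
  have hW : gu * sn - fu * cs = m * f := by
    rw [hgu, hfu, hf]
    linear_combination c * m * hsc
  have hV : fuu * cs - guu * sn = -m' * f + m ^ 2 * (c * cs - R) + R * ω ^ 2 := by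
    rw [hfuu, hguu, hf]
    linear_combination (-(m' * c) - R * m ^ 2 + R * ω ^ 2) * hsc
  have huu : (-(q' * b + q * (q * a)) * f + -(q * b) * fu + (-(q * b) * fu + a * fuu)) *
        ((q * a * f + b * fu) * cs - gu * (b * sn)) +
      ((q' * a + q * -(q * b)) * f + q * a * fu + (q * a * fu + b * fuu)) *
        (gu * (a * sn) - (-(q * b) * f + a * fu) * cs) +
      guu * ((-(q * b) * f + a * fu) * (b * sn) - (q * a * f + b * fu) * (a * sn)) =
      f * (q * (-m' * f + m ^ 2 * (c * cs - R) + R * ω ^ 2 - f * q ^ 2 * cs) +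
        (2 * fu * q + f * q') * m) := by
    linear_combination (f * q * (fuu * cs - guu * sn - f * q ^ 2 * cs) +
      (2 * fu * q + f * q') * (gu * sn - fu * cs)) * he + f * q * hV + (2 * fu * q + f * q') * hW
  have hvv : a * (cs * (1 / R)) * ((q * a * f + b * fu) * cs - gu * (b * sn)) +
      b * (cs * (1 / R)) * (gu * (a * sn) - (-(q * b) * f + a * fu) * cs) +
      -sn * (1 / R) * ((-(q * b) * f + a * fu) * (b * sn) - (q * a * f + b * fu) * (a * sn)) =
      f * q / R := by
    linear_combination f * q / R * (sn ^ 2 + cs ^ 2) * he + f * q / R * hsc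
  have huv : (-(q * b) * sn + a * (-ω * cs)) * ((q * a * f + b * fu) * cs - gu * (b * sn)) +
      (q * a * sn + b * (-ω * cs)) * (gu * (a * sn) - (-(q * b) * f + a * fu) * cs) +
      ω * sn * ((-(q * b) * f + a * fu) * (b * sn) - (q * a * f + b * fu) * (a * sn)) =
      f * q * (m * sn - ω) := by
    linear_combination (-(f * q * ω) * (sn ^ 2 + cs ^ 2) + q * sn * (gu * sn - fu * cs)) * he
      + q * sn * hW - f * q * ω * hsc
  rw [huu, hvv, huv, hfu]
  field_simp
  rw [hf]
  linear_combination (-(q ^ 2 * m ^ 2 * R * (c - R * cs) ^ 2)) * hsc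

theorem exists_continuous_log {A : Type*} [TopologicalSpace A] [SimplyConnectedSpace A]
    [LocallyPathConnectedSpace A] {G : A → ℂ} (hG : Continuous G) (h0 : ∀ z, G z ≠ 0)
    {a₀ : A} {e₀ : ℂ}
    (he₀ : Complex.exp e₀ = G a₀) :
    ∃ L : A → ℂ, Continuous L ∧ L a₀ = e₀ ∧ ∀ z, Complex.exp (L z) = G z := by
  obtain ⟨F, ⟨hF0, hF⟩, -⟩ := Complex.isCoveringMap_exp.existsUnique_continuousMap_lifts
    (⟨fun z => ⟨G z, h0 z⟩, hG.subtype_mk h0⟩ : C(A, {z : ℂ // z ≠ 0})) a₀ e₀ (Subtype.ext he₀)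
  exact ⟨F, F.continuous, hF0, fun z => congrArg Subtype.val (congrFun hF z)⟩

/-- A continuous function that avoids the window `(M, M + π)` and starts below it stays below. -/
theorem le_of_avoids_window {h : ℝ → ℝ} {α β M : ℝ} (hαβ : α ≤ β) (hc : ContinuousOn h (Icc α β))
    (h0 : h α ≤ M) (hav : ∀ x ∈ Icc α β, ¬ (M < h x ∧ h x < M + π)) : h β ≤ M := by
  by_contra! hM
  have hpi := pi_pos
  obtain ⟨x, hx, hxe⟩ := intermediate_value_Icc hαβ hc
    (show min (h β) (M + π / 2) ∈ Icc (h α) (h β) from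
      ⟨le_min (h0.trans hM.le) (by linarith), min_le_left _ _⟩)
  refine hav x hx ⟨?_, ?_⟩
  · rw [hxe]; exact lt_min hM (by linarith)
  · rw [hxe]; exact (min_le_right _ _).trans_lt (by linarith)

/-- Hopf's secant-map argument for an embedded arc `Z` with tangent angle `φ` that stays above its
initial point and to the right of its end point. -/
theorem tangent_angle_le_of_injOn {Z δ : ℝ → ℂ} {φ : ℝ → ℝ} {α β : ℝ} (hαβ : α < β)
    (hZ : ∀ u, HasDerivAt Z (δ u) u) (hδ : Continuous δ) (hφ : Continuous φ)
    (hδφ : ∀ u ∈ Icc α β, δ u = Complex.exp (φ u * Complex.I))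
    (hinj : InjOn Z (Icc α β)) (hφα : φ α = 0)
    (him : ∀ y ∈ Icc α β, 0 ≤ (Z y - Z α).im)
    (hre : ∀ x ∈ Icc α β, (Z β - Z x).re ≤ 0)
    (hδβ : (δ β).re ≤ 0) : φ β ≤ 3 * π / 2 := by
  let g : ℝ → ℝ → ℂ := fun x y => ∫ s in (0 : ℝ)..1, δ (x + s * (y - x))
  have hg : ∀ x y, ((y - x : ℝ) : ℂ) * g x y = Z y - Z x := by
    intro x y
    have h : ∀ s ∈ uIcc (0 : ℝ) 1, HasDerivAt (fun s : ℝ => Z (x + s * (y - x)))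
        (((y - x : ℝ) : ℂ) * δ (x + s * (y - x))) s := by
      intro s _
      have h1 : HasDerivAt (fun s : ℝ => x + s * (y - x)) (y - x) s := by
        simpa using ((hasDerivAt_id s).mul_const (y - x)).const_add x
      simpa using! (hZ (x + s * (y - x))).scomp s h1
    have := intervalIntegral.integral_eq_sub_of_hasDerivAt h
      (Continuous.intervalIntegrable (by fun_prop) _ _)
    rw [intervalIntegral.integral_const_mul] at this
    simpa using this
  have hgd : ∀ x, g x x = δ x := by intro x; simp [g]
  have hgc : Continuous (fun p : ℝ × ℝ => g p.1 p.2) := by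
    apply intervalIntegral.continuous_parametric_intervalIntegral_of_continuous'
    fun_prop
  let pr : ℝ → ℝ := fun x => projIcc α β hαβ.le x
  have hpr : Continuous pr := continuous_subtype_val.comp continuous_projIcc
  have hprm : ∀ x, pr x ∈ Icc α β := fun x => (projIcc α β hαβ.le x).2
  have hpre : ∀ x ∈ Icc α β, pr x = x := fun x hx => by simp [pr, projIcc_of_mem _ hx]
  have hα : α ∈ Icc α β := left_mem_Icc.2 hαβ.le
  have hβ : β ∈ Icc α β := right_mem_Icc.2 hαβ.le
  obtain ⟨L, hL, hL0, hLe⟩ := exists_continuous_log (A := ℝ × ℝ)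
    (G := fun p => g (pr p.1) (pr p.2))
    (hgc.comp (by fun_prop : Continuous fun p : ℝ × ℝ => (pr p.1, pr p.2)))
    (by
      rintro ⟨x, y⟩ h
      simp only at h
      have h1 := hg (pr x) (pr y)
      rw [h, mul_zero, eq_comm, sub_eq_zero] at h1
      have h2 := hinj (hprm y) (hprm x) h1
      rw [h2, hgd, hδφ _ (hprm x)] at h
      exact Complex.exp_ne_zero _ h) (a₀ := (α, α)) (e₀ := 0)
    (by simp [hpre α hα, hgd, hδφ α hα, hφα])
  have hLim : ∀ x ∈ Icc α β, ∀ y ∈ Icc α β,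
      (y - x) * (Real.exp (L (x, y)).re * Real.sin (L (x, y)).im) = (Z y - Z x).im := by
    intro x hx y hy
    have h := hLe (x, y)
    simp only [hpre x hx, hpre y hy] at h
    rw [← hg, ← h, Complex.im_ofReal_mul, Complex.exp_im]
  have hLre : ∀ x ∈ Icc α β, ∀ y ∈ Icc α β,
      (y - x) * (Real.exp (L (x, y)).re * Real.cos (L (x, y)).im) = (Z y - Z x).re := by
    intro x hx y hy
    have h := hLe (x, y)
    simp only [hpre x hx, hpre y hy] at h
    rw [← hg, ← h, Complex.re_ofReal_mul, Complex.exp_re]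
  have hLd : ∀ x ∈ Icc α β, Complex.exp (L (x, x)) = Complex.exp (φ x * Complex.I) := by
    intro x hx
    rw [hLe, ← hδφ x hx]
    simp only [hpre x hx, hgd]
  have hpi := pi_pos
  have h1 : (L (α, β)).im ≤ π := by
    refine le_of_avoids_window (h := fun y => (L (α, y)).im) hαβ.le (by fun_prop)
      (by simp [hL0, hpi.le]) ?_
    rintro y hy ⟨hy1, hy2⟩
    have hya : α < y := by
      rcases hy.1.eq_or_lt with h | h
      · rw [← h, hL0] at hy1
        simp at hy1
        linarith
      · exact h
    have h := him y hy
    rw [← hLim α hα y hy] at h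
    have hs : Real.sin (L (α, y)).im < 0 := by
      have := Real.sin_pos_of_pos_of_lt_pi (x := (L (α, y)).im - π) (by linarith) (by linarith)
      rw [Real.sin_sub_pi] at this
      linarith
    have := mul_neg_of_pos_of_neg (sub_pos.2 hya)
      (mul_neg_of_pos_of_neg (Real.exp_pos (L (α, y)).re) hs)
    linarith
  have h2 : (L (β, β)).im ≤ 3 * π / 2 := by
    refine le_of_avoids_window (h := fun x => (L (x, β)).im) hαβ.le (by fun_prop)
      (by linarith) ?_
    rintro x hx ⟨hx1, hx2⟩
    have hs : 0 < Real.cos (L (x, β)).im := by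
      have := Real.cos_pos_of_mem_Ioo (x := (L (x, β)).im - 2 * π) ⟨by linarith, by linarith⟩
      rwa [Real.cos_sub_two_pi] at this
    rcases hx.2.eq_or_lt with h | h
    · rw [h] at hs
      have h3 : δ β = Complex.exp (L (β, β)) := by rw [hLd β hβ, hδφ β hβ]
      rw [h3, Complex.exp_re] at hδβ
      have := mul_pos (Real.exp_pos (L (β, β)).re) hs
      linarith
    · have h3 := hre x hx
      rw [← hLre x hx β hβ] at h3
      have := mul_pos (sub_pos.2 h) (mul_pos (Real.exp_pos (L (x, β)).re) hs)
      linarith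
  have h3 : φ β - (L (β, β)).im ≤ 0 := by
    refine le_of_avoids_window (h := fun x => φ x - (L (x, x)).im) hαβ.le (by fun_prop)
      (by simp [hL0, hφα]) ?_
    rintro x hx ⟨hx1, hx2⟩
    obtain ⟨n, hn⟩ := Complex.exp_eq_exp_iff_exists_int.1 (hLd x hx)
    have hn' := congrArg Complex.im hn
    simp at hn'
    have hn1 : -1 < (n : ℝ) := by nlinarith
    have hn2 : (n : ℝ) < 0 := by nlinarith
    norm_cast at hn1 hn2
    omega
  linarith

namespace Ribbon

variable (Rb : Ribbon)

/-- The curvature `det (γ', γ'')` of the ribbon. -/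
def curv (u : ℝ) : ℝ := det2 (deriv Rb.γ u) (deriv (deriv Rb.γ) u)

/-- The signed distance `det (γ, γ')` from the origin to the tangent line. -/
def supp (u : ℝ) : ℝ := det2 (Rb.γ u) (deriv Rb.γ u)

theorem u₂_pos : 0 < Rb.u₂ := Rb.hu₁.trans Rb.h₁₂

theorem contDiff_deriv : ContDiff ℝ (⊤ : ℕ∞) (deriv Rb.γ) :=
  (contDiff_infty_iff_deriv.1 Rb.smooth).2

theorem contDiff_deriv_deriv : ContDiff ℝ (⊤ : ℕ∞) (deriv (deriv Rb.γ)) :=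
  (contDiff_infty_iff_deriv.1 Rb.contDiff_deriv).2

theorem hasDerivAt (u : ℝ) : HasDerivAt Rb.γ (deriv Rb.γ u) u :=
  ((contDiff_infty_iff_deriv.1 Rb.smooth).1 u).hasDerivAt

theorem hasDerivAt_deriv (u : ℝ) : HasDerivAt (deriv Rb.γ) (deriv (deriv Rb.γ) u) u :=
  ((contDiff_infty_iff_deriv.1 Rb.contDiff_deriv).1 u).hasDerivAt

theorem hasDerivAt_fst (u : ℝ) : HasDerivAt (fun s => (Rb.γ s).1) (deriv Rb.γ u).1 u :=
  (Rb.hasDerivAt u).fst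

theorem hasDerivAt_snd (u : ℝ) : HasDerivAt (fun s => (Rb.γ s).2) (deriv Rb.γ u).2 u :=
  (Rb.hasDerivAt u).snd

theorem hasDerivAt_deriv_fst (u : ℝ) :
    HasDerivAt (fun s => (deriv Rb.γ s).1) (deriv (deriv Rb.γ) u).1 u :=
  (Rb.hasDerivAt_deriv u).fst

theorem hasDerivAt_deriv_snd (u : ℝ) :
    HasDerivAt (fun s => (deriv Rb.γ s).2) (deriv (deriv Rb.γ) u).2 u :=
  (Rb.hasDerivAt_deriv u).snd

@[fun_prop]
theorem continuous_γ : Continuous Rb.γ := Rb.smooth.continuous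

@[fun_prop]
theorem continuous_deriv : Continuous (deriv Rb.γ) := Rb.contDiff_deriv.continuous

@[fun_prop]
theorem continuous_curv : Continuous Rb.curv := by
  have h1 := Rb.continuous_deriv
  have h2 := Rb.contDiff_deriv_deriv.continuous
  unfold curv det2
  fun_prop

@[fun_prop]
theorem continuous_supp : Continuous Rb.supp := by
  have h1 := Rb.continuous_γ
  have h2 := Rb.continuous_deriv
  unfold supp det2
  fun_prop

theorem deriv_sq {u : ℝ} (hu : u ∈ Icc (-Rb.u₃) Rb.u₃) :
    (deriv Rb.γ u).1 ^ 2 + (deriv Rb.γ u).2 ^ 2 = 1 := by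
  have h := Rb.arclength u hu
  rwa [norm2, Real.sqrt_eq_one] at h

theorem dot_deriv_deriv {u : ℝ} (hu : u ∈ Ioo (-Rb.u₃) Rb.u₃) :
    (deriv Rb.γ u).1 * (deriv (deriv Rb.γ) u).1 +
      (deriv Rb.γ u).2 * (deriv (deriv Rb.γ) u).2 = 0 := by
  have h := ((Rb.hasDerivAt_deriv_fst u).pow 2).add ((Rb.hasDerivAt_deriv_snd u).pow 2)
  have h' : HasDerivAt (fun _ : ℝ => (1 : ℝ)) _ u := h.congr_of_eventuallyEq (by
    filter_upwards [isOpen_Ioo.mem_nhds hu] with s hs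
    exact (Rb.deriv_sq (Ioo_subset_Icc_self hs)).symm)
  have := h'.unique (hasDerivAt_const u 1)
  simp at this
  linarith

theorem deriv_deriv_fst {u : ℝ} (hu : u ∈ Ioo (-Rb.u₃) Rb.u₃) :
    (deriv (deriv Rb.γ) u).1 = -(Rb.curv u * (deriv Rb.γ u).2) := by
  have h1 := Rb.deriv_sq (Ioo_subset_Icc_self hu)
  have h2 := Rb.dot_deriv_deriv hu
  rw [curv, det2]
  linear_combination -(deriv (deriv Rb.γ) u).1 * h1 + (deriv Rb.γ u).1 * h2

theorem deriv_deriv_snd {u : ℝ} (hu : u ∈ Ioo (-Rb.u₃) Rb.u₃) :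
    (deriv (deriv Rb.γ) u).2 = Rb.curv u * (deriv Rb.γ u).1 := by
  have h1 := Rb.deriv_sq (Ioo_subset_Icc_self hu)
  have h2 := Rb.dot_deriv_deriv hu
  rw [curv, det2]
  linear_combination -(deriv (deriv Rb.γ) u).2 * h1 + (deriv Rb.γ u).2 * h2

theorem deriv_neg_eq {u : ℝ} (hu : u ∈ Ioo (-Rb.u₃) Rb.u₃) :
    deriv Rb.γ (-u) = (-(deriv Rb.γ u).2, -(deriv Rb.γ u).1) := by
  have h1 := (Rb.hasDerivAt (-u)).scomp u (hasDerivAt_neg u)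
  have h2 := ((Rb.hasDerivAt_snd u).prodMk (Rb.hasDerivAt_fst u)).congr_of_eventuallyEq
    (f₁ := Rb.γ ∘ Neg.neg) (by
      filter_upwards [isOpen_Ioo.mem_nhds hu] with s hs
      exact Rb.symm s (Ioo_subset_Icc_self hs))
  have h3 := h1.unique h2
  rw [neg_one_smul, neg_eq_iff_eq_neg] at h3
  exact h3

theorem deriv_deriv_neg_eq {u : ℝ} (hu : u ∈ Ioo (-Rb.u₃) Rb.u₃) :
    deriv (deriv Rb.γ) (-u) = ((deriv (deriv Rb.γ) u).2, (deriv (deriv Rb.γ) u).1) := by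
  have h1 := (Rb.hasDerivAt_deriv (-u)).scomp u (hasDerivAt_neg u)
  have h2 := ((Rb.hasDerivAt_deriv_snd u).neg.prodMk
    (Rb.hasDerivAt_deriv_fst u).neg).congr_of_eventuallyEq
    (f₁ := deriv Rb.γ ∘ Neg.neg) (by
      filter_upwards [isOpen_Ioo.mem_nhds hu] with s hs
      exact Rb.deriv_neg_eq hs)
  have h3 := h1.unique h2
  rw [neg_one_smul, neg_eq_iff_eq_neg] at h3
  simpa using h3

theorem curv_neg {u : ℝ} (hu : u ∈ Ioo (-Rb.u₃) Rb.u₃) : Rb.curv (-u) = Rb.curv u := by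
  rw [curv, curv, Rb.deriv_neg_eq hu, Rb.deriv_deriv_neg_eq hu, det2, det2]
  ring

theorem supp_neg {u : ℝ} (hu : u ∈ Ioo (-Rb.u₃) Rb.u₃) : Rb.supp (-u) = Rb.supp u := by
  rw [supp, supp, Rb.deriv_neg_eq hu, Rb.symm u (Ioo_subset_Icc_self hu), det2, det2]
  ring

theorem u₂_mem : Rb.u₂ ∈ Ioo (-Rb.u₃) Rb.u₃ :=
  ⟨by linarith [Rb.u₂_pos, Rb.h₂₃], Rb.h₂₃⟩

theorem mem_Ioo_of_mem_Icc {u : ℝ} (hu : u ∈ Icc (-Rb.u₂) Rb.u₂) : u ∈ Ioo (-Rb.u₃) Rb.u₃ :=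
  ⟨by linarith [hu.1, Rb.h₂₃], hu.2.trans_lt Rb.h₂₃⟩

theorem γ_u₂ : Rb.γ Rb.u₂ = (0, Rb.a) := by
  simpa using Rb.segment Rb.u₂ (left_mem_Icc.2 Rb.h₂₃.le)

theorem γ_neg_u₂ : Rb.γ (-Rb.u₂) = (Rb.a, 0) := by
  rw [Rb.symm _ (Ioo_subset_Icc_self Rb.u₂_mem), γ_u₂]

theorem deriv_u₂ : deriv Rb.γ Rb.u₂ = (0, -1) := by
  have hm : Rb.u₂ ∈ Icc Rb.u₂ Rb.u₃ := left_mem_Icc.2 Rb.h₂₃.le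
  have h1 : HasDerivAt (fun u : ℝ => ((0 : ℝ), Rb.a - (u - Rb.u₂))) (0, -1) Rb.u₂ :=
    (hasDerivAt_const _ _).prodMk (((hasDerivAt_id _).sub_const _).const_sub _)
  have h2 : HasDerivWithinAt Rb.γ (0, -1) (Icc Rb.u₂ Rb.u₃) Rb.u₂ :=
    h1.hasDerivWithinAt.congr (fun u hu => Rb.segment u hu) (Rb.segment _ hm)
  exact (uniqueDiffOn_Icc Rb.h₂₃ _ hm).eq_deriv _ (Rb.hasDerivAt _).hasDerivWithinAt h2

theorem deriv_neg_u₂ : deriv Rb.γ (-Rb.u₂) = (1, 0) := by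
  rw [Rb.deriv_neg_eq Rb.u₂_mem, deriv_u₂]
  simp

theorem injOn_Icc : InjOn Rb.γ (Icc (-Rb.u₂) Rb.u₂) := by
  have key : ∀ u ∈ Icc (-Rb.u₂) Rb.u₂, u = -Rb.u₂ ∨ u = Rb.u₂ ∨ u ∈ Ioo (-Rb.u₂) Rb.u₂ := by
    intro u hu
    rcases hu.1.eq_or_lt with h | h
    · exact Or.inl h.symm
    · rcases hu.2.eq_or_lt with h' | h'
      · exact Or.inr (Or.inl h')
      · exact Or.inr (Or.inr ⟨h, h'⟩)
  have ha := Rb.ha.1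
  intro u hu v hv h
  rcases key u hu with rfl | rfl | hu' <;> rcases key v hv with rfl | rfl | hv'
  · rfl
  · rw [γ_u₂, γ_neg_u₂, Prod.mk.injEq] at h
    linarith
  · have := (Rb.quadrant v hv').2.1
    rw [← h, γ_neg_u₂] at this
    exact absurd this (lt_irrefl _)
  · rw [γ_u₂, γ_neg_u₂, Prod.mk.injEq] at h
    linarith
  · rfl
  · have := (Rb.quadrant v hv').1.1
    rw [← h, γ_u₂] at this
    exact absurd this (lt_irrefl _)
  · have := (Rb.quadrant u hu').2.1
    rw [h, γ_neg_u₂] at this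
    exact absurd this (lt_irrefl _)
  · have := (Rb.quadrant u hu').1.1
    rw [h, γ_u₂] at this
    exact absurd this (lt_irrefl _)
  · exact Rb.embedded hu' hv' h

theorem nonneg {u : ℝ} (hu : u ∈ Icc (-Rb.u₂) Rb.u₂) : 0 ≤ (Rb.γ u).1 ∧ 0 ≤ (Rb.γ u).2 := by
  have ha := Rb.ha.1.le
  rcases hu.1.eq_or_lt with h | h
  · rw [← h, γ_neg_u₂]; exact ⟨ha, le_rfl⟩
  · rcases hu.2.eq_or_lt with h' | h'
    · rw [h', γ_u₂]; exact ⟨le_rfl, ha⟩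
    · have := Rb.quadrant u ⟨h, h'⟩
      exact ⟨this.1.1.le, this.2.1.le⟩

theorem curv_pos {u : ℝ} (hu : u ∈ Ioo (-Rb.u₂) Rb.u₂) : 0 < Rb.curv u := Rb.convexArc u hu

/-- The tangent angle, normalized to vanish at `-u₂`. -/
def angle (u : ℝ) : ℝ := ∫ s in (-Rb.u₂)..u, Rb.curv s

theorem hasDerivAt_angle (u : ℝ) : HasDerivAt Rb.angle (Rb.curv u) u :=
  intervalIntegral.integral_hasDerivAt_right (Rb.continuous_curv.intervalIntegrable _ _)
    (Rb.continuous_curv.stronglyMeasurableAtFilter _ _) Rb.continuous_curv.continuousAt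

theorem angle_neg_u₂ : Rb.angle (-Rb.u₂) = 0 := by simp [angle]

theorem continuous_angle : Continuous Rb.angle :=
  continuous_iff_continuousAt.2 fun u => (Rb.hasDerivAt_angle u).continuousAt

theorem monotoneOn_angle : MonotoneOn Rb.angle (Icc (-Rb.u₂) Rb.u₂) := by
  refine monotoneOn_of_deriv_nonneg (convex_Icc _ _) Rb.continuous_angle.continuousOn
    (fun u _ => (Rb.hasDerivAt_angle u).differentiableAt.differentiableWithinAt) fun u hu => ?_
  rw [interior_Icc] at hu
  rw [(Rb.hasDerivAt_angle u).deriv]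
  exact (Rb.curv_pos hu).le

theorem deriv_eq_angle {u : ℝ} (hu : u ∈ Icc (-Rb.u₂) Rb.u₂) :
    deriv Rb.γ u = (cos (Rb.angle u), sin (Rb.angle u)) := by
  have hD : ∀ s ∈ Icc (-Rb.u₂) Rb.u₂, (deriv Rb.γ s).1 * cos (Rb.angle s) +
      (deriv Rb.γ s).2 * sin (Rb.angle s) = (deriv Rb.γ (-Rb.u₂)).1 * cos (Rb.angle (-Rb.u₂)) +
      (deriv Rb.γ (-Rb.u₂)).2 * sin (Rb.angle (-Rb.u₂)) := by
    have h : ∀ s ∈ Icc (-Rb.u₂) Rb.u₂, HasDerivAt (fun s => (deriv Rb.γ s).1 * cos (Rb.angle s) +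
        (deriv Rb.γ s).2 * sin (Rb.angle s)) 0 s := by
      intro s hs
      convert! ((Rb.hasDerivAt_deriv_fst s).mul (Rb.hasDerivAt_angle s).cos).add
        ((Rb.hasDerivAt_deriv_snd s).mul (Rb.hasDerivAt_angle s).sin) using 1
      rw [Rb.deriv_deriv_fst (Rb.mem_Ioo_of_mem_Icc hs),
        Rb.deriv_deriv_snd (Rb.mem_Ioo_of_mem_Icc hs)]
      ring
    exact constant_of_has_deriv_right_zero
      (fun s hs => (h s hs).continuousAt.continuousWithinAt)
      fun s hs => (h s (Ico_subset_Icc_self hs)).hasDerivWithinAt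
  have hE : ∀ s ∈ Icc (-Rb.u₂) Rb.u₂, (deriv Rb.γ s).2 * cos (Rb.angle s) -
      (deriv Rb.γ s).1 * sin (Rb.angle s) = (deriv Rb.γ (-Rb.u₂)).2 * cos (Rb.angle (-Rb.u₂)) -
      (deriv Rb.γ (-Rb.u₂)).1 * sin (Rb.angle (-Rb.u₂)) := by
    have h : ∀ s ∈ Icc (-Rb.u₂) Rb.u₂, HasDerivAt (fun s => (deriv Rb.γ s).2 * cos (Rb.angle s) -
        (deriv Rb.γ s).1 * sin (Rb.angle s)) 0 s := by
      intro s hs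
      convert! ((Rb.hasDerivAt_deriv_snd s).mul (Rb.hasDerivAt_angle s).cos).sub
        ((Rb.hasDerivAt_deriv_fst s).mul (Rb.hasDerivAt_angle s).sin) using 1
      rw [Rb.deriv_deriv_fst (Rb.mem_Ioo_of_mem_Icc hs),
        Rb.deriv_deriv_snd (Rb.mem_Ioo_of_mem_Icc hs)]
      ring
    exact constant_of_has_deriv_right_zero
      (fun s hs => (h s hs).continuousAt.continuousWithinAt)
      fun s hs => (h s (Ico_subset_Icc_self hs)).hasDerivWithinAt
  have h1 := hD u hu
  have h2 := hE u hu
  rw [deriv_neg_u₂, angle_neg_u₂, cos_zero, sin_zero] at h1 h2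
  have h3 := sin_sq_add_cos_sq (Rb.angle u)
  ext
  · simp only
    linear_combination cos (Rb.angle u) * h1 - sin (Rb.angle u) * h2 - (deriv Rb.γ u).1 * h3
  · simp only
    linear_combination sin (Rb.angle u) * h1 + cos (Rb.angle u) * h2 - (deriv Rb.γ u).2 * h3

theorem angle_u₂_le : Rb.angle Rb.u₂ ≤ 3 * π / 2 := by
  have hle : -Rb.u₂ < Rb.u₂ := by linarith [Rb.u₂_pos]
  have hγ := Rb.continuous_deriv
  refine tangent_angle_le_of_injOn (Z := fun u => ((Rb.γ u).1 : ℂ) + (Rb.γ u).2 * Complex.I)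
    (δ := fun u => ((deriv Rb.γ u).1 : ℂ) + (deriv Rb.γ u).2 * Complex.I) hle
    (fun u => (Rb.hasDerivAt_fst u).ofReal_comp.add
      ((Rb.hasDerivAt_snd u).ofReal_comp.mul_const _)) (by fun_prop) Rb.continuous_angle
    (fun u hu => ?_) (fun u hu v hv h => ?_) Rb.angle_neg_u₂ (fun u hu => ?_) (fun u hu => ?_) ?_
  · simp [Rb.deriv_eq_angle hu, Complex.exp_mul_I]
  · refine Rb.injOn_Icc hu hv (Prod.ext ?_ ?_)
    · simpa using congrArg Complex.re h
    · simpa using congrArg Complex.im h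
  · simpa [γ_neg_u₂] using (Rb.nonneg hu).2
  · simpa [γ_u₂] using (Rb.nonneg hu).1
  · simp [deriv_u₂]

theorem hasDerivAt_det_const (x : ℝ) (w : ℝ × ℝ) :
    HasDerivAt (fun s => det2 (Rb.γ s) w) (det2 (deriv Rb.γ x) w) x :=
  ((Rb.hasDerivAt_fst x).mul_const w.2).sub ((Rb.hasDerivAt_snd x).mul_const w.1)

theorem supp_nonneg {u : ℝ} (hu : u ∈ Icc (-Rb.u₂) Rb.u₂) : 0 ≤ Rb.supp u := by
  have hpi := pi_pos
  have hle : -Rb.u₂ ≤ Rb.u₂ := by linarith [Rb.u₂_pos]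
  have hder : ∀ x ∈ Icc (-Rb.u₂) Rb.u₂,
      det2 (deriv Rb.γ x) (deriv Rb.γ u) = sin (Rb.angle u - Rb.angle x) := by
    intro x hx
    rw [Rb.deriv_eq_angle hx, Rb.deriv_eq_angle hu, det2, sin_sub]
    ring
  have hcont : Continuous fun s => det2 (Rb.γ s) (deriv Rb.γ u) :=
    continuous_iff_continuousAt.2 fun x => (Rb.hasDerivAt_det_const x _).continuousAt
  have h0 : 0 ≤ Rb.angle u := by
    rw [← Rb.angle_neg_u₂]
    exact Rb.monotoneOn_angle (left_mem_Icc.2 hle) hu hu.1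
  have h1 : Rb.angle u ≤ 3 * π / 2 :=
    (Rb.monotoneOn_angle hu (right_mem_Icc.2 hle) hu.2).trans Rb.angle_u₂_le
  rcases le_total (Rb.angle u) π with h | h
  · have hmono : MonotoneOn (fun s => det2 (Rb.γ s) (deriv Rb.γ u)) (Icc (-Rb.u₂) u) := by
      refine monotoneOn_of_deriv_nonneg (convex_Icc _ _) hcont.continuousOn
        (fun x _ => (Rb.hasDerivAt_det_const x _).differentiableAt.differentiableWithinAt)
        fun x hx => ?_
      have hx' := interior_subset hx
      have hx2 : x ∈ Icc (-Rb.u₂) Rb.u₂ := ⟨hx'.1, hx'.2.trans hu.2⟩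
      rw [(Rb.hasDerivAt_det_const x _).deriv, hder x hx2]
      have ha := Rb.monotoneOn_angle hx2 hu hx'.2
      have hb := Rb.monotoneOn_angle (left_mem_Icc.2 hle) hx2 hx'.1
      rw [angle_neg_u₂] at hb
      exact sin_nonneg_of_nonneg_of_le_pi (by linarith) (by linarith)
    have := hmono (left_mem_Icc.2 hu.1) (right_mem_Icc.2 hu.1) hu.1
    refine le_trans ?_ this
    simp only [γ_neg_u₂, det2, Rb.deriv_eq_angle hu]
    have := mul_nonneg Rb.ha.1.le (sin_nonneg_of_nonneg_of_le_pi h0 h)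
    linarith
  · have hanti : AntitoneOn (fun s => det2 (Rb.γ s) (deriv Rb.γ u)) (Icc u Rb.u₂) := by
      refine antitoneOn_of_deriv_nonpos (convex_Icc _ _) hcont.continuousOn
        (fun x _ => (Rb.hasDerivAt_det_const x _).differentiableAt.differentiableWithinAt)
        fun x hx => ?_
      have hx' := interior_subset hx
      have hx2 : x ∈ Icc (-Rb.u₂) Rb.u₂ := ⟨hu.1.trans hx'.1, hx'.2⟩
      rw [(Rb.hasDerivAt_det_const x _).deriv, hder x hx2]
      have ha := Rb.monotoneOn_angle hu hx2 hx'.1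
      have hb := Rb.monotoneOn_angle hx2 (right_mem_Icc.2 hle) hx'.2
      have hc := Rb.angle_u₂_le
      exact sin_nonpos_of_nonpos_of_neg_pi_le (by linarith) (by linarith)
    have := hanti (left_mem_Icc.2 hu.2) (right_mem_Icc.2 hu.2) hu.2
    refine le_trans ?_ this
    simp only [γ_u₂, det2, Rb.deriv_eq_angle hu]
    have hc : cos (Rb.angle u) ≤ 0 := cos_nonpos_of_pi_div_two_le_of_le (by linarith) (by linarith)
    have := mul_nonneg Rb.ha.1.le (neg_nonneg.2 hc)
    linarith

theorem abs_dot_le {u : ℝ} (hu : u ∈ Icc (-Rb.u₃) Rb.u₃) :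
    |dot2 (Rb.γ u) (deriv Rb.γ u)| ≤ 1 := by
  have h1 := Rb.deriv_sq hu
  have h2 := Rb.inDisk u hu
  replace h2 := (Real.sqrt_le_iff.1 h2).2
  rw [dot2, abs_le]
  constructor <;> nlinarith [sq_nonneg ((Rb.γ u).1 - (deriv Rb.γ u).1),
    sq_nonneg ((Rb.γ u).2 - (deriv Rb.γ u).2), sq_nonneg ((Rb.γ u).1 + (deriv Rb.γ u).1),
    sq_nonneg ((Rb.γ u).2 + (deriv Rb.γ u).2)]

theorem hasDerivAt_supp {u : ℝ} (hu : u ∈ Ioo (-Rb.u₃) Rb.u₃) :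
    HasDerivAt Rb.supp (Rb.curv u * dot2 (Rb.γ u) (deriv Rb.γ u)) u := by
  convert! ((Rb.hasDerivAt_fst u).mul (Rb.hasDerivAt_deriv_snd u)).sub
    ((Rb.hasDerivAt_snd u).mul (Rb.hasDerivAt_deriv_fst u)) using 1
  rw [Rb.deriv_deriv_fst hu, Rb.deriv_deriv_snd hu, dot2]
  ring

theorem supp_le_of_mem_Ioo {u : ℝ} (hu : u ∈ Ioo Rb.u₁ Rb.u₂) :
    Rb.supp u ≤ Rb.u₂ * Rb.curv u := by
  have hu0 : 0 < u := Rb.hu₁.trans hu.1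
  have hsub : ∀ x ∈ Icc u Rb.u₂, x ∈ Ioo (-Rb.u₃) Rb.u₃ := fun x hx =>
    Rb.mem_Ioo_of_mem_Icc ⟨by linarith [hx.1, Rb.u₂_pos], hx.2⟩
  have hd : ∀ x ∈ Icc u Rb.u₂, HasDerivAt (fun x => Rb.supp x + Rb.curv u * x)
      (Rb.curv x * dot2 (Rb.γ x) (deriv Rb.γ x) + Rb.curv u * 1) x := fun x hx =>
    (Rb.hasDerivAt_supp (hsub x hx)).add ((hasDerivAt_id x).const_mul _)
  have hmono : MonotoneOn (fun x => Rb.supp x + Rb.curv u * x) (Icc u Rb.u₂) := by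
    refine monotoneOn_of_deriv_nonneg (convex_Icc _ _)
      (fun x hx => (hd x hx).continuousAt.continuousWithinAt)
      (fun x hx => (hd x (interior_subset hx)).differentiableAt.differentiableWithinAt)
      fun x hx => ?_
    have hxm := interior_subset hx
    rw [interior_Icc] at hx
    rw [(hd x hxm).deriv]
    have h1 := (abs_le.1 (Rb.abs_dot_le (Ioo_subset_Icc_self (hsub x hxm)))).1
    have h2 : Rb.curv x ≤ Rb.curv u :=
      (Rb.curvDecreasing hu ⟨hu.1.trans hx.1, hx.2⟩ hx.1).le
    have h3 := Rb.curv_pos (u := x) ⟨by linarith [hx.1, Rb.u₂_pos], hx.2⟩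
    nlinarith
  have h := hmono (left_mem_Icc.2 hu.2.le) (right_mem_Icc.2 hu.2.le) hu.2.le
  have h0 : Rb.supp Rb.u₂ = 0 := by simp [supp, γ_u₂, deriv_u₂, det2]
  simp only [h0] at h
  have := mul_pos (Rb.curv_pos (u := u) ⟨by linarith [Rb.u₂_pos], hu.2⟩) hu0
  linarith

theorem exists_supp_le : ∃ C : ℝ, 0 < C ∧ ∀ u ∈ Ioo (-Rb.u₂) Rb.u₂, Rb.supp u ≤ C * Rb.curv u := by
  have h12 := Rb.h₁₂
  have hu₂ := Rb.u₂_pos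
  have hsub : ∀ x ∈ Icc (-((Rb.u₁ + Rb.u₂) / 2)) ((Rb.u₁ + Rb.u₂) / 2), x ∈ Ioo (-Rb.u₂) Rb.u₂ :=
    fun x hx => ⟨by linarith [hx.1], by linarith [hx.2]⟩
  obtain ⟨K, hK⟩ := isCompact_Icc.exists_bound_of_continuousOn
    (s := Icc (-((Rb.u₁ + Rb.u₂) / 2)) ((Rb.u₁ + Rb.u₂) / 2))
    (f := fun x => Rb.supp x / Rb.curv x)
    (Rb.continuous_supp.continuousOn.div Rb.continuous_curv.continuousOn
      fun x hx => (Rb.curv_pos (hsub x hx)).ne')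
  refine ⟨max K Rb.u₂, lt_max_of_lt_right hu₂, fun u hu => ?_⟩
  have hκ := Rb.curv_pos hu
  have key : ∀ D ≤ max K Rb.u₂, Rb.supp u ≤ D * Rb.curv u → Rb.supp u ≤ max K Rb.u₂ * Rb.curv u :=
    fun D hD h => h.trans (mul_le_mul_of_nonneg_right hD hκ.le)
  by_cases hm : u ∈ Icc (-((Rb.u₁ + Rb.u₂) / 2)) ((Rb.u₁ + Rb.u₂) / 2)
  · exact key K (le_max_left _ _) ((div_le_iff₀ hκ).1 ((le_abs_self _).trans (hK u hm)))
  · apply key Rb.u₂ (le_max_right _ _)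
    rcases not_and_or.1 hm with h | h
    · have hu3 := Rb.mem_Ioo_of_mem_Icc (Ioo_subset_Icc_self hu)
      rw [← Rb.curv_neg hu3, ← Rb.supp_neg hu3]
      exact Rb.supp_le_of_mem_Ioo ⟨by linarith, by linarith [hu.1]⟩
    · exact Rb.supp_le_of_mem_Ioo ⟨by linarith, hu.2⟩

end Ribbon

namespace Ribbon

variable (Rb : Ribbon)

theorem norm2_pos {u : ℝ} (hu : u ∈ Ioo (-Rb.u₂) Rb.u₂) : 0 < norm2 (Rb.γ u) := by
  have := (Rb.quadrant u hu).1.1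
  exact Real.sqrt_pos.2 (by positivity)

theorem norm2_sq (u : ℝ) : norm2 (Rb.γ u) ^ 2 = (Rb.γ u).1 ^ 2 + (Rb.γ u).2 ^ 2 :=
  Real.sq_sqrt (by positivity)

theorem hasDerivAt_norm2 {u : ℝ} (hu : u ∈ Ioo (-Rb.u₂) Rb.u₂) :
    HasDerivAt (fun s => norm2 (Rb.γ s)) (dot2 (Rb.γ u) (deriv Rb.γ u) / norm2 (Rb.γ u)) u := by
  have hr := Rb.norm2_pos hu
  convert! (((Rb.hasDerivAt_fst u).pow 2).add ((Rb.hasDerivAt_snd u).pow 2)).sqrt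
    (Real.sqrt_pos.1 hr).ne' using 1
  simp only [Nat.cast_ofNat, Nat.add_one_sub_one, pow_one, Pi.add_apply, Pi.pow_apply]
  rw [← norm2, dot2]
  field_simp

theorem hasDerivAt_dot {u : ℝ} (hu : u ∈ Ioo (-Rb.u₃) Rb.u₃) :
    HasDerivAt (fun s => dot2 (Rb.γ s) (deriv Rb.γ s)) (1 - Rb.curv u * Rb.supp u) u := by
  convert! ((Rb.hasDerivAt_fst u).mul (Rb.hasDerivAt_deriv_fst u)).add
    ((Rb.hasDerivAt_snd u).mul (Rb.hasDerivAt_deriv_snd u)) using 1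
  have h := Rb.deriv_sq (Ioo_subset_Icc_self hu)
  rw [Rb.deriv_deriv_fst hu, Rb.deriv_deriv_snd hu, supp, det2]
  linear_combination -h

theorem dot_sq_add_supp_sq {u : ℝ} (hu : u ∈ Icc (-Rb.u₃) Rb.u₃) :
    dot2 (Rb.γ u) (deriv Rb.γ u) ^ 2 + Rb.supp u ^ 2 = norm2 (Rb.γ u) ^ 2 := by
  rw [norm2_sq, dot2, supp, det2]
  linear_combination ((Rb.γ u).1 ^ 2 + (Rb.γ u).2 ^ 2) * Rb.deriv_sq hu

/-- The distance of the center of the arc over `tγ(u)` from the origin. -/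
def centerDist (t u : ℝ) : ℝ := (1 / (t * norm2 (Rb.γ u)) + t * norm2 (Rb.γ u)) / 2

theorem RT_pos {t u : ℝ} (ht : 0 < t) (ht1 : t < 1) (hu : u ∈ Ioo (-Rb.u₂) Rb.u₂) :
    0 < RT Rb t u := by
  have hr := Rb.norm2_pos hu
  have hr1 := Rb.inDisk u (Ioo_subset_Icc_self (Rb.mem_Ioo_of_mem_Icc (Ioo_subset_Icc_self hu)))
  have h1 : t * norm2 (Rb.γ u) < 1 := by nlinarith
  have h2 : 1 < 1 / (t * norm2 (Rb.γ u)) := by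
    rw [lt_div_iff₀ (by positivity)]
    linarith
  rw [RT]
  linarith

theorem centerDist_sq {t u : ℝ} (ht : 0 < t) (hu : u ∈ Ioo (-Rb.u₂) Rb.u₂) :
    Rb.centerDist t u ^ 2 = 1 + RT Rb t u ^ 2 := by
  have hr := Rb.norm2_pos hu
  rw [centerDist, RT]
  field_simp
  ring

theorem centerDist_eq {t : ℝ} (u : ℝ) :
    Rb.centerDist t u = RT Rb t u + t * norm2 (Rb.γ u) := by
  rw [centerDist, RT]
  ring

theorem ψT_eq {t u : ℝ} (ht : 0 < t) (hu : u ∈ Ioo (-Rb.u₂) Rb.u₂) (v : ℝ) :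
    ψT Rb t u v =
      ((Rb.γ u).1 / norm2 (Rb.γ u) * (Rb.centerDist t u - RT Rb t u * cos (v / RT Rb t u)),
      (Rb.γ u).2 / norm2 (Rb.γ u) * (Rb.centerDist t u - RT Rb t u * cos (v / RT Rb t u)),
      RT Rb t u * sin (v / RT Rb t u)) := by
  have hr := Rb.norm2_pos hu
  have h : t * FT Rb t u v =
      (Rb.centerDist t u - RT Rb t u * cos (v / RT Rb t u)) / norm2 (Rb.γ u) := by
    rw [FT, centerDist_eq]
    field_simp
    ring
  rw [ψT, mul_right_comm t (Rb.γ u).1, mul_right_comm t (Rb.γ u).2, h]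
  simp only [Prod.mk.injEq, and_true]
  constructor <;> ring

/-- The Gaussian curvature numerator of the surface over the curved part of the ribbon. -/
theorem curvature_eq {t u : ℝ} (ht : 0 < t) (ht1 : t < 1) (hu : u ∈ Ioo (-Rb.u₂) Rb.u₂) (v : ℝ) :
    dot3 (ψTuu Rb t u v) (cross3 (ψTu Rb t u v) (ψTv Rb t u v)) *
        dot3 (ψTvv Rb t u v) (cross3 (ψTu Rb t u v) (ψTv Rb t u v)) -
      dot3 (ψTuv Rb t u v) (cross3 (ψTu Rb t u v) (ψTv Rb t u v)) ^ 2 =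
    (Rb.centerDist t u - RT Rb t u * cos (v / RT Rb t u)) ^ 3 / RT Rb t u *
      (Rb.supp u / norm2 (Rb.γ u) ^ 2) * ((Rb.supp u / norm2 (Rb.γ u) ^ 2 *
        (1 - cos (v / RT Rb t u)) - Rb.curv u) / norm2 (Rb.γ u) ^ 2) := by
  have hr : ∀ s ∈ Ioo (-Rb.u₂) Rb.u₂, norm2 (Rb.γ s) ≠ 0 := fun s hs => (Rb.norm2_pos hs).ne'
  have hru := hr u hu
  have hu3 := Rb.mem_Ioo_of_mem_Icc (Ioo_subset_Icc_self hu)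
  have he₁ : ∀ s ∈ Ioo (-Rb.u₂) Rb.u₂, HasDerivAt (fun s => (Rb.γ s).1 / norm2 (Rb.γ s))
      (-(Rb.supp s / norm2 (Rb.γ s) ^ 2 * ((Rb.γ s).2 / norm2 (Rb.γ s)))) s := by
    intro s hs
    convert! (Rb.hasDerivAt_fst s).div (Rb.hasDerivAt_norm2 hs) (hr s hs) using 1
    have := hr s hs
    have h2 := Rb.norm2_sq s
    rw [supp, det2, dot2]
    field_simp
    linear_combination (-(deriv Rb.γ s).1) * h2
  have he₂ : ∀ s ∈ Ioo (-Rb.u₂) Rb.u₂, HasDerivAt (fun s => (Rb.γ s).2 / norm2 (Rb.γ s))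
      (Rb.supp s / norm2 (Rb.γ s) ^ 2 * ((Rb.γ s).1 / norm2 (Rb.γ s))) s := by
    intro s hs
    convert! (Rb.hasDerivAt_snd s).div (Rb.hasDerivAt_norm2 hs) (hr s hs) using 1
    have := hr s hs
    have h2 := Rb.norm2_sq s
    rw [supp, det2, dot2]
    field_simp
    linear_combination (-(deriv Rb.γ s).2) * h2
  have hinv : ∀ s ∈ Ioo (-Rb.u₂) Rb.u₂, HasDerivAt (fun s => 1 / (t * norm2 (Rb.γ s)))
      (-(t * (dot2 (Rb.γ s) (deriv Rb.γ s) / norm2 (Rb.γ s))) / (t * norm2 (Rb.γ s)) ^ 2) s := by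
    intro s hs
    simpa using ((Rb.hasDerivAt_norm2 hs).const_mul t).fun_inv (mul_ne_zero ht.ne' (hr s hs))
  have hc : ∀ s ∈ Ioo (-Rb.u₂) Rb.u₂, HasDerivAt (Rb.centerDist t)
      (RT Rb t s * (-dot2 (Rb.γ s) (deriv Rb.γ s) / norm2 (Rb.γ s) ^ 2)) s := by
    intro s hs
    convert! ((hinv s hs).add ((Rb.hasDerivAt_norm2 hs).const_mul t)).div_const 2 using 1
    have := hr s hs
    rw [RT]
    field_simp
    ring
  have hR : ∀ s ∈ Ioo (-Rb.u₂) Rb.u₂, HasDerivAt (RT Rb t)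
      (Rb.centerDist t s * (-dot2 (Rb.γ s) (deriv Rb.γ s) / norm2 (Rb.γ s) ^ 2)) s := by
    intro s hs
    convert! ((hinv s hs).sub ((Rb.hasDerivAt_norm2 hs).const_mul t)).div_const 2 using 1
    have := hr s hs
    rw [centerDist]
    field_simp
    ring
  have hq := (Rb.hasDerivAt_supp hu3).fun_div ((Rb.hasDerivAt_norm2 hu).fun_pow 2)
    (pow_ne_zero 2 hru)
  have hm := (Rb.hasDerivAt_dot hu3).fun_neg.fun_div ((Rb.hasDerivAt_norm2 hu).fun_pow 2)
    (pow_ne_zero 2 hru)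
  have key := rotating_arcs_curvature (v := v) isOpen_Ioo hu (fun s hs w => Rb.ψT_eq ht hs w)
    he₁ he₂ hc hR (fun s hs => (Rb.RT_pos ht ht1 hs).ne')
    (by have := Rb.norm2_sq u; field_simp; linarith) hq hm
  refine key.trans ?_
  congr 1
  have hds := Rb.dot_sq_add_supp_sq (Ioo_subset_Icc_self hu3)
  generalize dot2 (Rb.γ u) (deriv Rb.γ u) = d at *
  generalize norm2 (Rb.γ u) = r at *
  generalize Rb.supp u = p at *
  generalize Rb.curv u = κ at *
  generalize cos (v / RT Rb t u) = cs at *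
  clear key hq hm hR hc hinv he₁ he₂
  simp only [Nat.cast_ofNat, Nat.add_one_sub_one, pow_one]
  field_simp
  linear_combination (-(κ * r ^ 2) - p * cs) * hds

end Ribbon

/-- **Proposition 3.3.** For every ribbon `γ` there is `t₀ ∈ (0,1]` such that for all
`t ∈ (0,t₀]`, the curved piece of the surface associated to the scaled ribbon `tγ` (the part
with `u ∈ (-u₂,u₂)` inside the closed unit ball) is saddle: its Gaussian curvature is
nonpositive, i.e. `⟨ψ_uu,n⟩⟨ψ_vv,n⟩ - ⟨ψ_uv,n⟩² ≤ 0` with `n = ψ_u × ψ_v`. -/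
theorem scaled_ribbon_surface_saddle (Rb : Ribbon) :
    ∃ t₀ ∈ Set.Ioc (0 : ℝ) 1, ∀ t ∈ Set.Ioc (0 : ℝ) t₀,
      ∀ u ∈ Set.Ioo (-Rb.u₂) Rb.u₂, ∀ v : ℝ, norm3 (ψT Rb t u v) ≤ 1 →
        dot3 (ψTuu Rb t u v) (cross3 (ψTu Rb t u v) (ψTv Rb t u v)) *
            dot3 (ψTvv Rb t u v) (cross3 (ψTu Rb t u v) (ψTv Rb t u v)) -
          dot3 (ψTuv Rb t u v) (cross3 (ψTu Rb t u v) (ψTv Rb t u v)) ^ 2 ≤ 0 := by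
  obtain ⟨C, hC, hsupp⟩ := Rb.exists_supp_le
  refine ⟨1 / (2 + 2 * C), ⟨by positivity, by rw [div_le_one (by positivity)]; linarith⟩, ?_⟩
  intro t ht u hu v hv
  have ht0 := ht.1
  have htC : t * (2 + 2 * C) ≤ 1 := (le_div_iff₀ (by positivity)).1 ht.2
  have ht1 : t < 1 := by nlinarith
  have hr := Rb.norm2_pos hu
  have hR := Rb.RT_pos ht0 ht1 hu
  have hc := Rb.centerDist_eq (t := t) u
  have hc2 := Rb.centerDist_sq ht0 hu
  have hp := Rb.supp_nonneg (Ioo_subset_Icc_self hu)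
  have hpC := hsupp u hu
  have hκ := Rb.curv_pos hu
  have hcs := cos_le_one (v / RT Rb t u)
  have hsc := sin_sq_add_cos_sq (v / RT Rb t u)
  have hcc : 2 * (t * norm2 (Rb.γ u)) * Rb.centerDist t u = 1 + (t * norm2 (Rb.γ u)) ^ 2 := by
    rw [Ribbon.centerDist]
    field_simp
  have hball : RT Rb t u ≤ Rb.centerDist t u * cos (v / RT Rb t u) := by
    rw [Rb.ψT_eq ht0 hu, norm3] at hv
    replace hv := (Real.sqrt_le_iff.1 hv).2
    have he : ((Rb.γ u).1 / norm2 (Rb.γ u)) ^ 2 + ((Rb.γ u).2 / norm2 (Rb.γ u)) ^ 2 = 1 := by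
      have := Rb.norm2_sq u
      field_simp
      linarith
    simp only [mul_pow] at hv
    rw [← add_mul, he] at hv
    have : RT Rb t u * RT Rb t u ≤
        RT Rb t u * (Rb.centerDist t u * cos (v / RT Rb t u)) := by nlinarith
    exact le_of_mul_le_mul_left this hR
  rw [Rb.curvature_eq ht0 ht1 hu]
  have hf : 0 ≤ Rb.centerDist t u - RT Rb t u * cos (v / RT Rb t u) := by nlinarith [mul_pos ht0 hr]
  have hcos : 1 - cos (v / RT Rb t u) ≤ 2 * t ^ 2 * norm2 (Rb.γ u) ^ 2 := by
    have hcpos : 0 < Rb.centerDist t u := by nlinarith [mul_pos ht0 hr]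
    have h1 : Rb.centerDist t u * (1 - cos (v / RT Rb t u)) ≤
        Rb.centerDist t u * (2 * t ^ 2 * norm2 (Rb.γ u) ^ 2) := by
      have : t * norm2 (Rb.γ u) ≤
          (t * norm2 (Rb.γ u)) * (2 * (t * norm2 (Rb.γ u)) * Rb.centerDist t u) := by
        rw [hcc]
        have := pow_pos (mul_pos ht0 hr) 3
        nlinarith
      nlinarith
    exact le_of_mul_le_mul_left h1 hcpos
  have hlast : Rb.supp u / norm2 (Rb.γ u) ^ 2 * (1 - cos (v / RT Rb t u)) - Rb.curv u ≤ 0 := by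
    have h1 : Rb.supp u / norm2 (Rb.γ u) ^ 2 * (1 - cos (v / RT Rb t u)) ≤
        Rb.supp u / norm2 (Rb.γ u) ^ 2 * (2 * t ^ 2 * norm2 (Rb.γ u) ^ 2) :=
      mul_le_mul_of_nonneg_left hcos (by positivity)
    have h2 : Rb.supp u / norm2 (Rb.γ u) ^ 2 * (2 * t ^ 2 * norm2 (Rb.γ u) ^ 2) =
        2 * t ^ 2 * Rb.supp u := by field_simp
    have h3 : 2 * t ^ 2 * Rb.supp u ≤ 2 * t ^ 2 * (C * Rb.curv u) :=
      mul_le_mul_of_nonneg_left hpC (by positivity)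
    have h4 : 2 * t ^ 2 * C ≤ 1 := by nlinarith [mul_pos ht0 hC, mul_pos (mul_pos ht0 hC) ht0]
    have h5 := mul_le_mul_of_nonneg_right h4 hκ.le
    linarith
  exact mul_nonpos_of_nonneg_of_nonpos (by positivity)
    (div_nonpos_of_nonpos_of_nonneg hlast (by positivity))
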